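/- Let a, b > 0 and θ ∈ (0,1). If f : ℝ → ℂ satisfies J^a f = (1-∂_x²)^{a/2} f ∈ L²(ℝ) and ⟨x⟩^b f ∈ L²(ℝ), where ⟨x⟩ = (1+x²)^{1/2}, then ⟨x⟩^{(1-θ)b} f ∈ H^{θa}(ℝ) with the estimate ‖J^{θa}(⟨x⟩^{(1-θ)b} f)‖_{L²} ≤ c ‖⟨x⟩^b f‖_{L²}^{1-θ} ‖J^a f‖_{L²}^{θ} for a constant c depending only on a, b, θ. -/

import Mathlib

open MeasureTheory
open scoped FourierTransform ENNReal


theorem fourier_toLp_ae {h : ℝ → ℂ} (h1 : Integrable h) (h2 : MemLp h 2) :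
    (𝓕 (h2.toLp h) : Lp (α := ℝ) ℂ 2) =ᵐ[volume] 𝓕 h := by
  have hcont : Continuous (𝓕 h) :=
    VectorFourier.fourierIntegral_continuous Real.continuous_fourierChar
      (by exact continuous_inner) h1
  apply ae_eq_of_integral_contDiff_smul_eq
  · exact (Lp.memLp _).locallyIntegrable (by norm_num)
  · exact hcont.locallyIntegrable
  · intro g hg hgc
    have hg1 : HasCompactSupport (fun x => (g x : ℂ)) := hgc.comp_left (g := fun y : ℝ => (y : ℂ)) (by simp)
    have hg2 : ContDiff ℝ (⊤ : ℕ∞) (fun x => (g x : ℂ)) := Complex.ofRealCLM.contDiff.comp hg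
    set G : SchwartzMap ℝ ℂ := hg1.toSchwartzMap hg2 with hG
    have hGx : ∀ x, G x = (g x : ℂ) := fun x => rfl
    have e1 := congrArg (fun T => T G) (Lp.fourier_toTemperedDistribution_eq (h2.toLp h))
    simp only [TemperedDistribution.fourier_apply, Lp.toTemperedDistribution_apply] at e1
    have e2 : ∫ x, (𝓕 G) x • (h2.toLp h) x = ∫ x, 𝓕 (G : ℝ → ℂ) x • h x := by
      apply integral_congr_ae
      filter_upwards [h2.coeFn_toLp] with x hx
      rw [hx, SchwartzMap.fourier_coe]
    have e3 : ∫ x, 𝓕 (G : ℝ → ℂ) x • h x = ∫ x, G x • 𝓕 h x := by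
      have := VectorFourier.integral_fourierIntegral_smul_eq_flip (L := innerₗ ℝ) (μ := volume)
        (ν := volume) Real.continuous_fourierChar (by exact continuous_inner)
        G.integrable h1
      simpa using! this
    have e4 : ∀ k : ℝ → ℂ, ∫ x, g x • k x = ∫ x, G x • k x := by
      intro k
      congr 1
    rw [e4, e4, ← e3, ← e2, e1]

theorem planch_eq {h : ℝ → ℂ} (h1 : Integrable h) (h2 : MemLp h 2) :
    ∫⁻ ξ, ‖𝓕 h ξ‖ₑ ^ 2 = ∫⁻ x, ‖h x‖ₑ ^ 2 := by
  have key : eLpNorm (𝓕 h) 2 volume = eLpNorm h 2 volume := by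
    rw [← eLpNorm_congr_ae (fourier_toLp_ae h1 h2), ← eLpNorm_congr_ae h2.coeFn_toLp]
    have := Lp.norm_fourier_eq (h2.toLp h)
    rw [Lp.norm_def, Lp.norm_def] at this
    exact (ENNReal.toReal_eq_toReal_iff' (Lp.eLpNorm_ne_top _) (Lp.eLpNorm_ne_top _)).1 this
  have gen : ∀ k : ℝ → ℂ, ∫⁻ x, ‖k x‖ₑ ^ 2 = eLpNorm k 2 volume ^ (2:ℝ) := by
    intro k
    have := eLpNorm_nnreal_pow_eq_lintegral (f := k) (μ := volume) (p := 2) (by norm_num)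
    simp at this
    simp [this]
  rw [gen, gen, key]

theorem planch_le {h : ℝ → ℂ} (h1 : Integrable h) :
    ∫⁻ ξ, ‖𝓕 h ξ‖ₑ ^ 2 ≤ ∫⁻ x, ‖h x‖ₑ ^ 2 := by
  by_cases ht : ∫⁻ x, ‖h x‖ₑ ^ 2 = ⊤
  · rw [ht]; exact le_top
  · refine (planch_eq h1 ⟨h1.1, ?_⟩).le
    rw [eLpNorm_lt_top_iff_lintegral_rpow_enorm_lt_top (by norm_num) (by norm_num)]
    simpa using lt_top_iff_ne_top.2 ht

theorem deriv_bound (k : ℕ) : ∀ (j : ℕ) (r : ℝ), ∃ C : ℝ, 0 ≤ C ∧ ∀ t : ℝ,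
    |iteratedDeriv k (fun t : ℝ => t ^ j * (1 + t ^ 2) ^ r) t| ≤ C * (1 + t ^ 2) ^ (r + j / 2) := by
  have hp : ∀ t : ℝ, 0 < 1 + t ^ 2 := fun t => by positivity
  have hsm : ∀ (j : ℕ) (r : ℝ) (n : ℕ), ContDiff ℝ n (fun t : ℝ => t ^ j * (1 + t ^ 2) ^ r) := by
    intro j r n
    exact (contDiff_id.pow j).mul
      ((contDiff_const.add (contDiff_id.pow 2)).rpow_const_of_ne fun t => (hp t).ne')
  induction k with
  | zero =>
    intro j r
    refine ⟨1, zero_le_one, fun t => ?_⟩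
    rw [iteratedDeriv_zero, one_mul, Real.rpow_add (hp t), abs_mul, mul_comm,
      abs_of_pos (Real.rpow_pos_of_pos (hp t) r)]
    gcongr
    rw [abs_pow]
    have h1 : |t| ≤ (1 + t ^ 2) ^ (1 / 2 : ℝ) := by
      rw [← Real.sqrt_eq_rpow]
      exact Real.abs_le_sqrt (by linarith)
    calc |t| ^ j ≤ ((1 + t ^ 2) ^ (1 / 2 : ℝ)) ^ j := by gcongr
      _ = _ := by
        rw [← Real.rpow_natCast, ← Real.rpow_mul (hp t).le]; congr 1; ring
  | succ k ih =>
    intro j r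
    obtain ⟨C1, hC1, h1⟩ := ih (j - 1) r
    obtain ⟨C2, hC2, h2⟩ := ih (j + 1) (r - 1)
    refine ⟨j * C1 + |2 * r| * C2, by positivity, fun t => ?_⟩
    have hd : deriv (fun t : ℝ => t ^ j * (1 + t ^ 2) ^ r) =
        (fun t : ℝ => (j : ℝ) * (t ^ (j - 1) * (1 + t ^ 2) ^ r)) +
          fun t : ℝ => (2 * r) * (t ^ (j + 1) * (1 + t ^ 2) ^ (r - 1)) := by
      ext t
      have ha : HasDerivAt (fun t : ℝ => 1 + t ^ 2) (2 * t) t := by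
        simpa using (hasDerivAt_pow 2 t).const_add 1
      have hb := (hasDerivAt_pow j t).mul (ha.rpow_const (p := r) (Or.inl (hp t).ne'))
      rw [show (fun t : ℝ => t ^ j * (1 + t ^ 2) ^ r) =
        ((fun t : ℝ => t ^ j) * fun t : ℝ => (1 + t ^ 2) ^ r) from rfl, hb.deriv]
      simp only [Pi.add_apply]
      ring
    rw [iteratedDeriv_succ', hd, iteratedDeriv_add
      ((contDiff_const.mul (hsm _ _ _)).contDiffAt) ((contDiff_const.mul (hsm _ _ _)).contDiffAt),
      iteratedDeriv_const_mul_field, iteratedDeriv_const_mul_field]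
    have hmono : ∀ s : ℝ, s ≤ r + j / 2 → (1 + t ^ 2) ^ s ≤ (1 + t ^ 2) ^ (r + j / 2) :=
      fun s hs => Real.rpow_le_rpow_of_exponent_le (by nlinarith [sq_nonneg t]) hs
    have hj : ((j - 1 : ℕ) : ℝ) ≤ j := by exact_mod_cast Nat.sub_le j 1
    calc _ ≤ |(j : ℝ) * iteratedDeriv k (fun t : ℝ => t ^ (j - 1) * (1 + t ^ 2) ^ r) t| +
            |(2 * r) * iteratedDeriv k (fun t : ℝ => t ^ (j + 1) * (1 + t ^ 2) ^ (r - 1)) t| :=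
          abs_add_le _ _
      _ ≤ j * (C1 * (1 + t ^ 2) ^ (r + j / 2)) + |2 * r| * (C2 * (1 + t ^ 2) ^ (r + j / 2)) := by
          rw [abs_mul, abs_mul, Nat.abs_cast]
          gcongr
          · exact (h1 t).trans (mul_le_mul_of_nonneg_left (hmono _ (by linarith)) hC1)
          · refine (h2 t).trans (mul_le_mul_of_nonneg_left (hmono _ ?_) hC2)
            push_cast; linarith
      _ = _ := by ring
theorem contDiff_p (r : ℝ) (n : ℕ∞) : ContDiff ℝ n (fun t : ℝ => (1 + t ^ 2) ^ r) :=
  (contDiff_const.add (contDiff_id.pow 2)).rpow_const_of_ne fun t => by positivity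

theorem peetre (x y r : ℝ) (hr : 0 ≤ r) :
    (1 + (x + y) ^ 2) ^ r ≤ 2 ^ r * (1 + x ^ 2) ^ r * (1 + y ^ 2) ^ r := by
  rw [← Real.mul_rpow (by positivity) (by positivity), ← Real.mul_rpow (by positivity) (by positivity)]
  apply Real.rpow_le_rpow (by positivity) _ hr
  nlinarith [sq_nonneg (x - y), sq_nonneg (x * y)]

theorem integrable_p (r : ℝ) (hr : r ≤ -1) : Integrable (fun t : ℝ => (1 + t ^ 2) ^ r) := by
  have := integrable_rpow_neg_one_add_norm_sq (E := ℝ) (μ := volume) (r := -2 * r) (by simp; linarith)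
  convert this using 2 with t
  simp

/-- localized weight -/
noncomputable def chi (r M x t : ℝ) : ℝ := (1 + t ^ 2) ^ r * ((1 + x ^ 2) ^ (-r) * (1 + (t - x) ^ 2) ^ (-M))

theorem contDiff_chi (r M x : ℝ) (n : ℕ∞) : ContDiff ℝ n (chi r M x) := by
  unfold chi
  exact (contDiff_p r n).mul (contDiff_const.mul ((contDiff_p (-M) n).comp (contDiff_id.sub contDiff_const)))

theorem chi_deriv (k : ℕ) (r M : ℝ) (hr : 0 ≤ r) : ∃ C : ℝ, 0 ≤ C ∧ ∀ x t : ℝ,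
    ‖iteratedFDeriv ℝ k (chi r M x) t‖ ≤ C * (1 + (t - x) ^ 2) ^ (r - M) := by
  have hb : ∀ (s : ℝ), ∀ i : ℕ, ∃ C : ℝ, 0 ≤ C ∧ ∀ t : ℝ,
      ‖iteratedFDeriv ℝ i (fun t : ℝ => (1 + t ^ 2) ^ s) t‖ ≤ C * (1 + t ^ 2) ^ s := by
    intro s i
    obtain ⟨C, hC, h⟩ := deriv_bound i 0 s
    refine ⟨C, hC, fun t => ?_⟩
    rw [norm_iteratedFDeriv_eq_norm_iteratedDeriv]
    simpa using h t
  choose A hA hA' using hb r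
  choose B hB hB' using hb (-M)
  refine ⟨∑ i ∈ Finset.range (k + 1), (k.choose i : ℝ) * A i * B (k - i) * 2 ^ r, ?_, fun x t => ?_⟩
  · exact Finset.sum_nonneg fun i _ => by have := hA i; have := hB (k - i); positivity
  have h1 := norm_iteratedFDeriv_mul_le (𝕜 := ℝ) (n := k) (N := (k : ℕ∞))
    (f := fun t : ℝ => (1 + t ^ 2) ^ r)
    (g := fun t : ℝ => (1 + x ^ 2) ^ (-r) • (1 + (t - x) ^ 2) ^ (-M)) (contDiff_p r k)
    (ContDiff.const_smul _ ((contDiff_p (-M) k).comp (contDiff_id.sub contDiff_const))) t le_rfl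
  refine h1.trans ?_
  rw [Finset.sum_mul]
  refine Finset.sum_le_sum fun i _ => ?_
  have h2 : ‖iteratedFDeriv ℝ (k - i) (fun t : ℝ => (1 + x ^ 2) ^ (-r) • (1 + (t - x) ^ 2) ^ (-M)) t‖
      ≤ (1 + x ^ 2) ^ (-r) * (B (k - i) * (1 + (t - x) ^ 2) ^ (-M)) := by
    have hcc : ContDiff ℝ ((k - i : ℕ) : ℕ∞) (fun t : ℝ => (1 + (t - x) ^ 2) ^ (-M)) :=
      (contDiff_p (-M) (k - i : ℕ)).comp (contDiff_id.sub contDiff_const)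
    rw [iteratedFDeriv_const_smul_apply' (hcc.contDiffAt), norm_smul,
      Real.norm_of_nonneg (by positivity)]
    gcongr
    rw [iteratedFDeriv_comp_sub (f := fun t : ℝ => (1 + t ^ 2) ^ (-M))]
    exact hB' _ _
  have h3 := peetre x (t - x) r hr
  rw [add_sub_cancel] at h3
  have hx : 0 < 1 + x ^ 2 := by positivity
  have ht : 0 < 1 + (t - x) ^ 2 := by positivity
  calc _ ≤ (k.choose i : ℝ) * (A i * (1 + t ^ 2) ^ r) * ((1 + x ^ 2) ^ (-r) * (B (k - i) * (1 + (t - x) ^ 2) ^ (-M))) := by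
        have := hA i
        gcongr
        exact hA' _ _
    _ ≤ (k.choose i : ℝ) * (A i * (2 ^ r * (1 + x ^ 2) ^ r * (1 + (t - x) ^ 2) ^ r)) * ((1 + x ^ 2) ^ (-r) * (B (k - i) * (1 + (t - x) ^ 2) ^ (-M))) := by
        have := hA i
        have := hB (k - i)
        gcongr
    _ = _ := by
        rw [sub_eq_add_neg r M, Real.rpow_add ht, Real.rpow_neg hx.le]
        have : (1 + x ^ 2) ^ r ≠ 0 := by positivity
        field_simp

theorem chi_decay (r M : ℝ) (hr : 0 ≤ r) (hM : r + 1 ≤ M) (N : ℕ) : ∃ C : ℝ, 0 ≤ C ∧ ∀ x : ℝ,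
    Integrable (fun t => (chi r M x t : ℂ)) ∧
    ∀ ζ : ℝ, ‖𝓕 (fun t => (chi r M x t : ℂ)) ζ‖ ≤ C * (1 + ζ ^ 2) ^ (-(N : ℝ)) := by
  choose A hA hA' using fun k => chi_deriv k r M hr
  have hI := integrable_p (r - M) (by linarith)
  set I := ∫ t : ℝ, (1 + t ^ 2) ^ (r - M) with hIdef
  have hI0 : 0 ≤ I := integral_nonneg fun t => by positivity
  have hnorm : ∀ k x t, ‖iteratedDeriv k (fun t => (chi r M x t : ℂ)) t‖ ≤ A k * (1 + (t - x) ^ 2) ^ (r - M) := by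
    intro k x t
    rw [← norm_iteratedFDeriv_eq_norm_iteratedDeriv]
    have := Complex.ofRealLI.norm_iteratedFDeriv_comp_left (f := chi r M x) (x := t) (i := k) (n := (k : ℕ∞))
      ((contDiff_chi r M x k).contDiffAt) le_rfl
    rw [show (fun t => (chi r M x t : ℂ)) = Complex.ofRealLI ∘ chi r M x from rfl, this]
    exact hA' k x t
  have hcd : ∀ x (n : ℕ∞), ContDiff ℝ n (fun t => (chi r M x t : ℂ)) := fun x n =>
    Complex.ofRealCLM.contDiff.comp (contDiff_chi r M x n)
  have hinteg : ∀ (k : ℕ) x, Integrable (iteratedDeriv k (fun t => (chi r M x t : ℂ))) := by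
    intro k x
    refine ((hI.comp_sub_right x).const_mul (A k)).mono'
      ((hcd x k).continuous_iteratedDeriv k le_rfl).aestronglyMeasurable ?_
    exact Filter.Eventually.of_forall (hnorm k x)
  have hF : ∀ (k : ℕ) x ζ, ‖𝓕 (iteratedDeriv k (fun t => (chi r M x t : ℂ))) ζ‖ ≤ A k * I := by
    intro k x ζ
    refine (VectorFourier.norm_fourierIntegral_le_integral_norm _ _ _ _ _).trans ?_
    refine (integral_mono (hinteg k x).norm ((hI.comp_sub_right x).const_mul (A k)) (hnorm k x)).trans ?_
    rw [integral_const_mul, integral_sub_right_eq_self (fun t : ℝ => (1 + t ^ 2) ^ (r - M))]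
  refine ⟨2 ^ N * (A 0 * I + A (2 * N) * I), ?_, fun x => ⟨?_, fun ζ => ?_⟩⟩
  · have := hA 0; have := hA (2 * N); positivity
  · simpa using hinteg 0 x
  · have h0 := hF 0 x ζ
    have h1 := hF (2 * N) x ζ
    rw [iteratedDeriv_zero] at h0
    rw [Real.fourier_iteratedDeriv (N := ⊤) (hcd x _) (fun n _ => hinteg n x) (by exact le_top)] at h1
    set u := ‖𝓕 (fun t => (chi r M x t : ℂ)) ζ‖ with hu
    have h2 : (ζ ^ 2) ^ N * u ≤ A (2 * N) * I := by
      refine le_trans ?_ h1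
      rw [norm_smul, norm_pow]
      have hz : |ζ| ≤ ‖2 * (Real.pi : ℂ) * Complex.I * (ζ : ℂ)‖ := by
        simp only [norm_mul, Complex.norm_I, Complex.norm_real, Real.norm_eq_abs, mul_one,
          abs_of_pos Real.pi_pos, Complex.norm_ofNat]
        nlinarith [abs_nonneg ζ, Real.pi_gt_three]
      rw [← hu, ← sq_abs, ← pow_mul]
      gcongr
    have h3 : (1 + ζ ^ 2) ^ N ≤ 2 ^ N * (1 + (ζ ^ 2) ^ N) := by
      have := add_pow_le zero_le_one (sq_nonneg ζ) N
      rw [one_pow] at this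
      refine this.trans ?_
      gcongr
      · norm_num
      · exact Nat.sub_le _ _
    rw [Real.rpow_neg (by positivity), Real.rpow_natCast, ← div_eq_mul_inv, le_div_iff₀ (by positivity)]
    have hu0 : 0 ≤ u := norm_nonneg _
    calc u * (1 + ζ ^ 2) ^ N ≤ u * (2 ^ N * (1 + (ζ ^ 2) ^ N)) := by gcongr
      _ = 2 ^ N * (u + (ζ ^ 2) ^ N * u) := by ring
      _ ≤ _ := by gcongr

theorem continuous_fourier' {h : ℝ → ℂ} (h1 : Integrable h) : Continuous (𝓕 h) :=
  VectorFourier.fourierIntegral_continuous Real.continuous_fourierChar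
      (by exact continuous_inner) h1

theorem stft_continuous {g : ℝ → ℂ} (hg : Integrable g) {φ : ℝ → ℝ} (hφ : Continuous φ)
    {B : ℝ} (hB : ∀ t, |φ t| ≤ B) :
    Continuous (fun q : ℝ × ℝ => 𝓕 (fun t => (φ (t - q.1) : ℂ) * g t) q.2) := by
  simp only [Real.fourier_real_eq]
  refine continuous_of_dominated (bound := fun t => B * ‖g t‖) ?_ ?_ (hg.norm.const_mul B) ?_
  · intro q
    have h1 : Continuous fun t : ℝ => (Real.fourierChar (-(t * q.2)) : ℂ) * (φ (t - q.1) : ℂ) := by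
      fun_prop
    refine (h1.aestronglyMeasurable.mul hg.1).congr (Filter.Eventually.of_forall fun t => ?_)
    simp [Circle.smul_def, mul_assoc]
  · intro q
    refine Filter.Eventually.of_forall fun t => ?_
    rw [Circle.norm_smul, norm_mul, Complex.norm_real, Real.norm_eq_abs]
    gcongr
    exact hB _
  · refine Filter.Eventually.of_forall fun t => ?_
    fun_prop

open Convolution in
theorem stft_planch {g : ℝ → ℂ} (hg : Integrable g) {φ : ℝ → ℝ}
    (hφi : Integrable φ) (hev : ∀ t, φ (-t) = φ t)
    {B : ℝ} (hB : ∀ t, |φ t| ≤ B) (ξ : ℝ) :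
    ∫⁻ x, ‖𝓕 (fun t => (φ (t - x) : ℂ) * g t) ξ‖ₑ ^ 2 =
      ∫⁻ η, ‖𝓕 g (η + ξ)‖ₑ ^ 2 * ‖𝓕 (fun t => (φ t : ℂ)) η‖ₑ ^ 2 := by
  set u : ℝ → ℂ := fun t => Real.fourierChar (-(t * ξ)) • g t with hu
  have hui : Integrable u := by
    have := (Real.fourierIntegral_convergent_iff (f := g) (μ := volume) ξ).2 hg
    simpa [hu, mul_comm] using this
  have hφc : Integrable (fun t => (φ t : ℂ)) := hφi.ofReal
  set v : ℝ → ℂ := u ⋆[ContinuousLinearMap.mul ℂ ℂ] (fun t => (φ t : ℂ)) with hv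
  have hveq : ∀ x, 𝓕 (fun t => (φ (t - x) : ℂ) * g t) ξ = v x := by
    intro x
    rw [Real.fourier_real_eq, hv, convolution_def]
    congr 1
    ext t
    simp only [hu, ContinuousLinearMap.mul_apply', Circle.smul_def, smul_eq_mul]
    rw [← hev (t - x), neg_sub]
    ring
  have hvi : Integrable v := hui.integrable_convolution _ hφc
  have hvb : ∀ x, ‖v x‖ ≤ B * ∫ t, ‖g t‖ := by
    intro x
    rw [← hveq, ← integral_const_mul]
    refine (VectorFourier.norm_fourierIntegral_le_integral_norm _ _ _ _ _).trans ?_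
    refine integral_mono_of_nonneg (Filter.Eventually.of_forall fun t => norm_nonneg _) (hg.norm.const_mul B) (Filter.Eventually.of_forall fun t => ?_)
    simp only [norm_mul, Complex.norm_real, Real.norm_eq_abs]
    gcongr
    exact hB _
  have hv2 : MemLp v 2 := by
    rw [memLp_two_iff_integrable_sq_norm hvi.1]
    refine (hvi.norm.const_mul (B * ∫ t, ‖g t‖)).mono' (hvi.1.norm.pow 2)
      (Filter.Eventually.of_forall fun x => ?_)
    rw [Real.norm_of_nonneg (by positivity), sq]
    exact mul_le_mul_of_nonneg_right (hvb x) (norm_nonneg _)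
  simp_rw [hveq]
  rw [← planch_eq hvi hv2]
  refine lintegral_congr fun η => ?_
  rw [hv, Real.fourier_mul_convolution_eq hui hφc, enorm_mul, mul_pow]
  congr 3
  rw [Real.fourier_real_eq, Real.fourier_real_eq]
  congr 1
  ext t
  simp only [hu, smul_smul, ← AddChar.map_add_eq_mul]
  congr 2
  ring



/-- The weight `(1 + x²)^r` with values in `ℝ≥0∞`. -/
noncomputable def wt (r x : ℝ) : ℝ≥0∞ := ENNReal.ofReal ((1 + x ^ 2) ^ r)

theorem wt_continuous (r : ℝ) : Continuous (wt r) := by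
  unfold wt
  refine ENNReal.continuous_ofReal.comp ?_
  exact (by fun_prop : Continuous fun x : ℝ => 1 + x ^ 2).rpow_const fun x => Or.inl (by positivity)

theorem wt_measurable (r : ℝ) : Measurable (wt r) := (wt_continuous r).measurable

theorem wt_mul (r s x : ℝ) : wt r x * wt s x = wt (r + s) x := by
  unfold wt
  rw [← ENNReal.ofReal_mul (by positivity), Real.rpow_add (by positivity)]

theorem wt_zero (x : ℝ) : wt 0 x = 1 := by simp [wt]

theorem wt_ne_zero (r x : ℝ) : wt r x ≠ 0 := by
  unfold wt
  have : 0 < (1 + x ^ 2) ^ r := by positivity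
  simpa using this

theorem wt_neg (r x : ℝ) : wt r (-x) = wt r x := by simp [wt]

theorem wt_rpow (r q x : ℝ) (hq : 0 ≤ q) : wt r x ^ q = wt (r * q) x := by
  unfold wt
  rw [ENNReal.ofReal_rpow_of_nonneg (by positivity) hq, Real.rpow_mul (by positivity)]

theorem wt_sq (r x : ℝ) : wt r x ^ 2 = wt (2 * r) x := by
  rw [sq, wt_mul, two_mul]

theorem wt_peetre (x y r : ℝ) (hr : 0 ≤ r) :
    wt r (x + y) ≤ ENNReal.ofReal (2 ^ r) * wt r x * wt r y := by
  unfold wt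
  rw [← ENNReal.ofReal_mul (by positivity), ← ENNReal.ofReal_mul (by positivity)]
  exact ENNReal.ofReal_le_ofReal (peetre x y r hr)

theorem lintegral_wt (r : ℝ) (hr : r ≤ -1) : ∫⁻ x, wt r x ≠ ⊤ :=
  (integrable_p r hr).lintegral_lt_top.ne

theorem wt_mono {r s : ℝ} (h : r ≤ s) (x : ℝ) : wt r x ≤ wt s x := by
  unfold wt
  exact ENNReal.ofReal_le_ofReal
    (Real.rpow_le_rpow_of_exponent_le (by nlinarith [sq_nonneg x]) h)

theorem ofReal_wt (r x : ℝ) (z : ℂ) :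
    ENNReal.ofReal ((1 + x ^ 2) ^ r * ‖z‖ ^ 2) = wt r x * ‖z‖ₑ ^ 2 := by
  unfold wt
  rw [ENNReal.ofReal_mul (by positivity), ENNReal.ofReal_pow (norm_nonneg _), ofReal_norm]

theorem enorm_wt (r x : ℝ) : ‖(((1 + x ^ 2) ^ r : ℝ) : ℂ)‖ₑ = wt r x := by
  unfold wt
  rw [← ofReal_norm, Complex.norm_real, Real.norm_of_nonneg (by positivity)]

theorem mult_pointwise {χ F : ℝ → ℂ} (hc : Continuous χ) (hi : Integrable χ)
    (hX : Integrable (𝓕 χ)) (hF : Integrable F) (ξ : ℝ) :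
    ‖𝓕 (fun t => χ t * F t) ξ‖ₑ ≤ ∫⁻ ζ, ‖𝓕 χ ζ‖ₑ * ‖𝓕 F (ξ - ζ)‖ₑ := by
  set G : ℝ → ℂ := fun t => Real.fourierChar (-(t * ξ)) • F t with hG
  have hGi : Integrable G := by
    have := (Real.fourierIntegral_convergent_iff (f := F) (μ := volume) ξ).2 hF
    simpa [hG, mul_comm] using this
  have hinv : 𝓕⁻ (𝓕 χ) = χ := hc.fourierInv_fourier_eq hi hX
  have hGF : ∀ ζ, 𝓕⁻ G ζ = 𝓕 F (ξ - ζ) := by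
    intro ζ
    rw [Real.fourierInv_eq', Real.fourier_eq']
    congr 1
    ext t
    simp only [hG, Circle.smul_def, Real.fourierChar_apply, smul_eq_mul, ← mul_assoc, ← Complex.exp_add]
    congr 2
    simp
    ring
  have e : ∫ ζ, 𝓕⁻ (𝓕 χ) ζ • G ζ = ∫ ζ, 𝓕 χ ζ • 𝓕⁻ G ζ := by
    have := VectorFourier.integral_fourierIntegral_smul_eq_flip (L := -innerₗ ℝ) (μ := volume)
        (ν := volume) (f := 𝓕 χ) (g := G) Real.continuous_fourierChar
        (by exact continuous_inner.neg) hX hGi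
    have hfl : (-innerₗ ℝ : ℝ →ₗ[ℝ] ℝ →ₗ[ℝ] ℝ).flip = -innerₗ ℝ := by
      ext; simp
    rw [hfl] at this
    exact this
  have e2 : 𝓕 (fun t => χ t * F t) ξ = ∫ ζ, 𝓕 χ ζ * 𝓕 F (ξ - ζ) := by
    rw [hinv] at e
    simp only [hGF, smul_eq_mul] at e
    rw [← e, Real.fourier_real_eq]
    congr 1
    ext t
    simp only [hG, Circle.smul_def, smul_eq_mul]
    ring
  rw [e2]
  refine (enorm_integral_le_lintegral_enorm _).trans (le_of_eq ?_)
  simp only [enorm_mul]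

theorem mult_bound (s C N : ℝ) (hs : 0 ≤ s) (hN : s / 2 + 1 ≤ N) :
    ∃ K : ℝ≥0∞, K ≠ ⊤ ∧ ∀ χ F : ℝ → ℂ, Continuous χ → Integrable χ →
      (∀ ζ, ‖𝓕 χ ζ‖ ≤ C * (1 + ζ ^ 2) ^ (-N)) → Integrable F →
      ∫⁻ ξ, wt s ξ * ‖𝓕 (fun t => χ t * F t) ξ‖ₑ ^ 2 ≤ K * ∫⁻ ξ, wt s ξ * ‖𝓕 F ξ‖ₑ ^ 2 := by
  set D : ℝ≥0∞ := ENNReal.ofReal (2 ^ (s / 2)) * ENNReal.ofReal C with hD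
  set I : ℝ≥0∞ := ∫⁻ ζ, wt (s / 2 - N) ζ with hI
  have hIt : I ≠ ⊤ := lintegral_wt _ (by linarith)
  have hDt : D ≠ ⊤ := ENNReal.mul_ne_top ENNReal.ofReal_ne_top ENNReal.ofReal_ne_top
  refine ⟨D ^ 2 * (I * I), by finiteness, ?_⟩
  intro χ F hc hi hdec hF
  have hC : ∀ ζ, ‖𝓕 χ ζ‖ₑ ≤ ENNReal.ofReal C * wt (-N) ζ := by
    intro ζ
    unfold wt
    rw [← ENNReal.ofReal_mul' (by positivity), ← ofReal_norm]
    exact ENNReal.ofReal_le_ofReal (hdec ζ)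
  have hX : Integrable (𝓕 χ) :=
    ((integrable_p (-N) (by linarith)).const_mul C).mono'
      (continuous_fourier' hi).aestronglyMeasurable (Filter.Eventually.of_forall hdec)
  set H : ℝ → ℝ≥0∞ := fun ξ => wt (s / 2) ξ * ‖𝓕 F ξ‖ₑ with hH
  have hHm : Measurable H := (wt_measurable _).mul (continuous_fourier' hF).enorm.measurable
  have hH2 : ∀ ξ, H ξ ^ 2 = wt s ξ * ‖𝓕 F ξ‖ₑ ^ 2 := by
    intro ξ
    rw [hH, mul_pow, wt_sq, mul_div_cancel₀ _ two_ne_zero]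
  have h1 : ∀ ξ, wt (s / 2) ξ * ‖𝓕 (fun t => χ t * F t) ξ‖ₑ ≤
      D * ∫⁻ ζ, wt (s / 2 - N) ζ * H (ξ - ζ) := by
    intro ξ
    refine (mul_le_mul_right (mult_pointwise hc hi hX hF ξ) _).trans ?_
    rw [← lintegral_const_mul' _ _ (by simp [wt]), ← lintegral_const_mul' _ _ hDt]
    refine lintegral_mono fun ζ => ?_
    have hp := wt_peetre ζ (ξ - ζ) (s / 2) (by positivity)
    rw [add_sub_cancel] at hp
    calc wt (s / 2) ξ * (‖𝓕 χ ζ‖ₑ * ‖𝓕 F (ξ - ζ)‖ₑ)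
        ≤ (ENNReal.ofReal (2 ^ (s / 2)) * wt (s / 2) ζ * wt (s / 2) (ξ - ζ)) *
          ((ENNReal.ofReal C * wt (-N) ζ) * ‖𝓕 F (ξ - ζ)‖ₑ) := by
          gcongr
          exact hC ζ
      _ = _ := by
          rw [sub_eq_add_neg (s / 2) N, ← wt_mul, hD, hH]
          ring
  have h2 : ∀ ξ, (∫⁻ ζ, wt (s / 2 - N) ζ * H (ξ - ζ)) ^ 2 ≤
      I * ∫⁻ ζ, wt (s / 2 - N) ζ * H (ξ - ζ) ^ 2 := by
    intro ξ
    have hm : Measurable fun ζ => H (ξ - ζ) := hHm.comp (by fun_prop)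
    have := ENNReal.lintegral_mul_norm_pow_le (μ := volume) (f := wt (s / 2 - N))
      (g := fun ζ => wt (s / 2 - N) ζ * H (ξ - ζ) ^ 2) (wt_measurable _).aemeasurable
      ((wt_measurable _).mul (hm.pow_const 2)).aemeasurable
      (p := 1 / 2) (q := 1 / 2) (by norm_num) (by norm_num) (by norm_num)
    have e : ∀ ζ, wt (s / 2 - N) ζ ^ (1 / 2 : ℝ) *
        (wt (s / 2 - N) ζ * H (ξ - ζ) ^ 2) ^ (1 / 2 : ℝ) = wt (s / 2 - N) ζ * H (ξ - ζ) := by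
      intro ζ
      rw [ENNReal.mul_rpow_of_nonneg _ _ (by norm_num), ← mul_assoc,
        ← ENNReal.rpow_add_of_nonneg _ _ (by norm_num) (by norm_num), ← ENNReal.rpow_natCast,
        ← ENNReal.rpow_mul]
      norm_num
    simp only [e] at this
    have e3 : ∀ A : ℝ≥0∞, (A ^ (1 / 2 : ℝ)) ^ 2 = A := by
      intro A
      rw [← ENNReal.rpow_natCast, ← ENNReal.rpow_mul]
      norm_num
    calc _ ≤ _ := pow_le_pow_left' this 2
      _ = _ := by rw [mul_pow, e3, e3]
  calc ∫⁻ ξ, wt s ξ * ‖𝓕 (fun t => χ t * F t) ξ‖ₑ ^ 2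
      = ∫⁻ ξ, (wt (s / 2) ξ * ‖𝓕 (fun t => χ t * F t) ξ‖ₑ) ^ 2 := by
        refine lintegral_congr fun ξ => ?_
        rw [mul_pow, wt_sq, mul_div_cancel₀ _ two_ne_zero]
    _ ≤ ∫⁻ ξ, (D ^ 2 * I) * ∫⁻ ζ, wt (s / 2 - N) ζ * H (ξ - ζ) ^ 2 := by
        refine lintegral_mono fun ξ => ?_
        refine (pow_le_pow_left' (h1 ξ) 2).trans ?_
        rw [mul_pow, mul_assoc]
        exact mul_le_mul_right (h2 ξ) _
    _ = (D ^ 2 * I) * ∫⁻ ξ, ∫⁻ ζ, wt (s / 2 - N) ζ * H (ξ - ζ) ^ 2 := by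
        rw [lintegral_const_mul' _ _ (by finiteness)]
    _ = (D ^ 2 * I) * ∫⁻ ζ, ∫⁻ ξ, wt (s / 2 - N) ζ * H (ξ - ζ) ^ 2 := by
        rw [lintegral_lintegral_swap]
        exact (((wt_measurable _).comp measurable_snd).mul
          ((hHm.comp (measurable_fst.sub measurable_snd)).pow_const 2)).aemeasurable
    _ = (D ^ 2 * I) * ∫⁻ ζ, wt (s / 2 - N) ζ * ∫⁻ ξ, H ξ ^ 2 := by
        congr 1
        refine lintegral_congr fun ζ => ?_
        rw [lintegral_const_mul' _ _ (by simp [wt]),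
          lintegral_sub_right_eq_self (fun ξ => H ξ ^ 2)]
    _ = _ := by
        rw [lintegral_mul_const _ (wt_measurable _)]
        simp only [hH2]
        ring

theorem stft_weighted {g : ℝ → ℂ} (hg : Integrable g) {φ : ℝ → ℝ} (hφ : Continuous φ)
    (hφi : Integrable φ) (hev : ∀ t, φ (-t) = φ t)
    {B : ℝ} (hB : ∀ t, |φ t| ≤ B) (s : ℝ) :
    ∫⁻ x, ∫⁻ ξ, wt s ξ * ‖𝓕 (fun t => (φ (t - x) : ℂ) * g t) ξ‖ₑ ^ 2 =
      ∫⁻ η, ‖𝓕 (fun t => (φ t : ℂ)) η‖ₑ ^ 2 * ∫⁻ ξ, wt s (ξ - η) * ‖𝓕 g ξ‖ₑ ^ 2 := by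
  have hm1 : Continuous (𝓕 g) := continuous_fourier' hg
  have hm2 : Continuous (𝓕 (fun t => (φ t : ℂ))) := continuous_fourier' hφi.ofReal
  rw [lintegral_lintegral_swap]
  swap
  · exact (((wt_measurable _).comp measurable_snd).mul
      ((stft_continuous hg hφ hB).enorm.measurable.pow_const 2)).aemeasurable
  calc _ = ∫⁻ ξ, ∫⁻ η, wt s ξ * (‖𝓕 g (η + ξ)‖ₑ ^ 2 * ‖𝓕 (fun t => (φ t : ℂ)) η‖ₑ ^ 2) := by
        refine lintegral_congr fun ξ => ?_
        rw [lintegral_const_mul' _ _ (by simp [wt]), lintegral_const_mul' _ _ (by simp [wt]),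
          stft_planch hg hφi hev hB]
    _ = ∫⁻ η, ∫⁻ ξ, wt s ξ * (‖𝓕 g (η + ξ)‖ₑ ^ 2 * ‖𝓕 (fun t => (φ t : ℂ)) η‖ₑ ^ 2) := by
        rw [lintegral_lintegral_swap]
        refine (((wt_measurable _).comp measurable_fst).mul (Measurable.mul ?_ ?_)).aemeasurable
        · exact (hm1.comp (continuous_snd.add continuous_fst)).enorm.measurable.pow_const 2
        · exact (hm2.comp continuous_snd).enorm.measurable.pow_const 2
    _ = _ := by
        refine lintegral_congr fun η => ?_
        rw [← lintegral_const_mul' _ _ (by finiteness),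
          ← lintegral_sub_right_eq_self (μ := volume) (fun ξ => wt s ξ *
            (‖𝓕 g (η + ξ)‖ₑ ^ 2 * ‖𝓕 (fun t => (φ t : ℂ)) η‖ₑ ^ 2)) η]
        refine lintegral_congr fun ξ => ?_
        rw [add_sub_cancel]
        ring

/-- The algebraic window `(1 + t²)^(-M)`. -/
noncomputable def win (M t : ℝ) : ℝ := (1 + t ^ 2) ^ (-M)

theorem win_continuous (M : ℝ) : Continuous (win M) := (contDiff_p (-M) 0).continuous

theorem win_integrable {M : ℝ} (hM : 1 ≤ M) : Integrable (win M) := integrable_p _ (by linarith)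

theorem win_even (M t : ℝ) : win M (-t) = win M t := by simp [win]

theorem win_bound {M : ℝ} (hM : 0 ≤ M) (t : ℝ) : |win M t| ≤ 1 := by
  unfold win
  rw [abs_of_nonneg (by positivity)]
  exact Real.rpow_le_one_of_one_le_of_nonpos (by nlinarith [sq_nonneg t]) (by linarith)

theorem enorm_win (M t : ℝ) : ‖(win M t : ℂ)‖ₑ = wt (-M) t := enorm_wt _ _

theorem win_mul_integrable {M : ℝ} (hM : 0 ≤ M) {f : ℝ → ℂ} (hf : Integrable f) (x : ℝ) :
    Integrable (fun t => (win M (t - x) : ℂ) * f t) := by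
  refine hf.norm.mono' ?_ (Filter.Eventually.of_forall fun t => ?_)
  · exact (Complex.continuous_ofReal.comp ((win_continuous M).comp
      (continuous_id.sub continuous_const))).aestronglyMeasurable.mul hf.1
  · rw [norm_mul, Complex.norm_real, Real.norm_eq_abs]
    exact mul_le_of_le_one_left (norm_nonneg _) (win_bound hM _)

/-- Upper bound in the space variable. -/
theorem boundA (b M : ℝ) (hb : 0 ≤ b) (hM : b + 1 ≤ M) : ∃ K : ℝ≥0∞, K ≠ ⊤ ∧
    ∀ f : ℝ → ℂ, Integrable f →
      ∫⁻ x, ∫⁻ ξ, wt b x * ‖𝓕 (fun t => (win M (t - x) : ℂ) * f t) ξ‖ₑ ^ 2 ≤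
        K * ∫⁻ t, wt b t * ‖f t‖ₑ ^ 2 := by
  set I : ℝ≥0∞ := ∫⁻ u, wt (b + 2 * -M) u with hI
  have hIt : I ≠ ⊤ := lintegral_wt _ (by linarith)
  refine ⟨ENNReal.ofReal (2 ^ b) * I, by finiteness, fun f hf => ?_⟩
  calc _ ≤ ∫⁻ x, ∫⁻ t, wt b x * (wt (2 * -M) (t - x) * ‖f t‖ₑ ^ 2) := by
        refine lintegral_mono fun x => ?_
        rw [lintegral_const_mul' _ _ (by simp [wt]), lintegral_const_mul' _ _ (by simp [wt])]
        refine mul_le_mul_right ((planch_le (win_mul_integrable (by linarith) hf x)).trans ?_) _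
        refine le_of_eq (lintegral_congr fun t => ?_)
        rw [enorm_mul, mul_pow, enorm_win, wt_sq]
    _ = ∫⁻ t, ∫⁻ x, wt b x * (wt (2 * -M) (t - x) * ‖f t‖ₑ ^ 2) := by
        rw [lintegral_lintegral_swap]
        refine ((wt_measurable _).comp measurable_fst).aemeasurable.mul
          (((wt_measurable _).comp (measurable_snd.sub measurable_fst)).aemeasurable.mul ?_)
        exact (hf.1.comp_snd).enorm.pow_const 2
    _ ≤ ∫⁻ t, (ENNReal.ofReal (2 ^ b) * I) * (wt b t * ‖f t‖ₑ ^ 2) := by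
        refine lintegral_mono fun t => ?_
        calc _ ≤ ∫⁻ x, (ENNReal.ofReal (2 ^ b) * (wt b t * ‖f t‖ₑ ^ 2)) * wt (b + 2 * -M) (t - x) := by
              refine lintegral_mono fun x => ?_
              have hp := wt_peetre t (-(t - x)) b hb
              rw [wt_neg, show t + -(t - x) = x by ring] at hp
              refine (mul_le_mul_left hp _).trans (le_of_eq ?_)
              rw [← wt_mul]
              ring
          _ = _ := by
              rw [lintegral_const_mul' _ _ (by simp [wt]; finiteness),
                lintegral_sub_left_eq_self (μ := volume) (fun u => wt (b + 2 * -M) u) t]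
              ring
    _ = _ := by rw [lintegral_const_mul' _ _ (by finiteness)]

/-- Upper bound in the frequency variable. -/
theorem boundB (a M : ℝ) (ha : 0 ≤ a) (hM : 1 ≤ M) : ∃ K : ℝ≥0∞, K ≠ ⊤ ∧
    ∀ f : ℝ → ℂ, Integrable f →
      ∫⁻ x, ∫⁻ ξ, wt a ξ * ‖𝓕 (fun t => (win M (t - x) : ℂ) * f t) ξ‖ₑ ^ 2 ≤
        K * ∫⁻ ξ, wt a ξ * ‖𝓕 f ξ‖ₑ ^ 2 := by
  obtain ⟨C, hC, hdec⟩ := chi_decay 0 M le_rfl (by linarith) (⌈a⌉₊ + 1)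
  have hN : a + 1 ≤ ((⌈a⌉₊ + 1 : ℕ) : ℝ) := by push_cast; linarith [Nat.le_ceil a]
  set N : ℝ := ((⌈a⌉₊ + 1 : ℕ) : ℝ) with hNdef
  have hψ : ∀ η, ‖𝓕 (fun t => (win M t : ℂ)) η‖ₑ ≤ ENNReal.ofReal C * wt (-N) η := by
    intro η
    have h1 := (hdec 0).2 η
    have h2 : (fun t => (chi 0 M 0 t : ℂ)) = fun t => (win M t : ℂ) := by
      ext t; simp [chi, win]
    rw [h2] at h1
    unfold wt
    rw [← ENNReal.ofReal_mul' (by positivity), ← ofReal_norm]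
    exact ENNReal.ofReal_le_ofReal h1
  set I : ℝ≥0∞ := ∫⁻ u, wt (a + 2 * -N) u with hI
  have hIt : I ≠ ⊤ := lintegral_wt _ (by linarith)
  refine ⟨ENNReal.ofReal C ^ 2 * ENNReal.ofReal (2 ^ a) * I, by finiteness, fun f hf => ?_⟩
  rw [stft_weighted hf (win_continuous M) (win_integrable hM) (win_even M)
    (win_bound (by linarith)) a]
  set Y := ∫⁻ ξ, wt a ξ * ‖𝓕 f ξ‖ₑ ^ 2 with hY
  calc _ ≤ ∫⁻ η, (ENNReal.ofReal C ^ 2 * ENNReal.ofReal (2 ^ a)) * wt (a + 2 * -N) η * Y := by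
        refine lintegral_mono fun η => ?_
        have h1 : ∫⁻ ξ, wt a (ξ - η) * ‖𝓕 f ξ‖ₑ ^ 2 ≤ ENNReal.ofReal (2 ^ a) * wt a η * Y := by
          rw [hY, ← lintegral_const_mul' _ _ (by simp [wt]; finiteness)]
          refine lintegral_mono fun ξ => ?_
          have hp := wt_peetre ξ (-η) a ha
          rw [wt_neg, ← sub_eq_add_neg] at hp
          refine (mul_le_mul_left hp _).trans (le_of_eq ?_)
          ring
        calc _ ≤ (ENNReal.ofReal C * wt (-N) η) ^ 2 * (ENNReal.ofReal (2 ^ a) * wt a η * Y) := by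
              gcongr
              exact hψ η
          _ = _ := by
              rw [← wt_mul, mul_pow, wt_sq]
              ring
    _ = _ := by
        rw [lintegral_mul_const _ ((wt_measurable _).const_mul _),
          lintegral_const_mul _ (wt_measurable _)]

/-- Lower bound in the frequency variable. -/
theorem boundC (s M : ℝ) (hs : 0 ≤ s) (hM : 1 ≤ M) : ∃ K : ℝ≥0∞, K ≠ ⊤ ∧
    ∀ g : ℝ → ℂ, Integrable g →
      ∫⁻ ξ, wt s ξ * ‖𝓕 g ξ‖ₑ ^ 2 ≤
        K * ∫⁻ x, ∫⁻ ξ, wt s ξ * ‖𝓕 (fun t => (win M (t - x) : ℂ) * g t) ξ‖ₑ ^ 2 := by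
  have hwi : Integrable (fun t => (win M t : ℂ)) := (win_integrable hM).ofReal
  have hcont : Continuous (𝓕 (fun t => (win M t : ℂ))) := continuous_fourier' hwi
  have hsq : ∫⁻ t, ‖(win M t : ℂ)‖ₑ ^ 2 = ∫⁻ t, wt (2 * -M) t := by
    simp only [enorm_win, wt_sq]
  have hsqt : ∫⁻ t, wt (2 * -M) t ≠ ⊤ := lintegral_wt _ (by linarith)
  have hwm : Measurable fun η => ‖𝓕 (fun t => (win M t : ℂ)) η‖ₑ ^ 2 * wt (-s) η :=
    (hcont.enorm.measurable.pow_const 2).mul (wt_measurable _)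
  set c0 : ℝ≥0∞ := ∫⁻ η, ‖𝓕 (fun t => (win M t : ℂ)) η‖ₑ ^ 2 * wt (-s) η with hc0
  have hc0t : c0 ≠ ⊤ := by
    refine ne_top_of_le_ne_top hsqt ?_
    rw [← hsq]
    refine le_trans (lintegral_mono fun η => ?_) (planch_le hwi)
    calc _ ≤ ‖𝓕 (fun t => (win M t : ℂ)) η‖ₑ ^ 2 * wt 0 η :=
          mul_le_mul_right (wt_mono (by linarith) η) _
      _ = _ := by rw [wt_zero, mul_one]
  have hc00 : c0 ≠ 0 := by
    intro h0
    rw [hc0, lintegral_eq_zero_iff hwm] at h0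
    have h1 : ∫⁻ η, ‖𝓕 (fun t => (win M t : ℂ)) η‖ₑ ^ 2 = 0 := by
      rw [lintegral_eq_zero_iff (hcont.enorm.measurable.pow_const 2)]
      filter_upwards [h0] with η hη
      exact (mul_eq_zero.1 hη).resolve_right (wt_ne_zero _ _)
    have h2 : MemLp (fun t => (win M t : ℂ)) 2 := by
      refine ⟨hwi.1, ?_⟩
      rw [eLpNorm_lt_top_iff_lintegral_rpow_enorm_lt_top (by norm_num) (by norm_num)]
      simpa using lt_top_iff_ne_top.2 (hsq ▸ hsqt)
    rw [planch_eq hwi h2, hsq, lintegral_eq_zero_iff (wt_measurable _)] at h1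
    obtain ⟨x, hx⟩ := h1.exists
    exact wt_ne_zero _ _ hx
  refine ⟨ENNReal.ofReal (2 ^ s) * c0⁻¹, ENNReal.mul_ne_top ENNReal.ofReal_ne_top
    (ENNReal.inv_ne_top.2 hc00), fun g hg => ?_⟩
  rw [stft_weighted hg (win_continuous M) (win_integrable hM) (win_even M)
    (win_bound (by linarith)) s]
  set Y := ∫⁻ ξ, wt s ξ * ‖𝓕 g ξ‖ₑ ^ 2 with hY
  set Z := ∫⁻ η, ‖𝓕 (fun t => (win M t : ℂ)) η‖ₑ ^ 2 * ∫⁻ ξ, wt s (ξ - η) * ‖𝓕 g ξ‖ₑ ^ 2 with hZ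
  have key : Y * c0 ≤ ENNReal.ofReal (2 ^ s) * Z := by
    rw [hc0, hZ, ← lintegral_const_mul' _ _ ENNReal.ofReal_ne_top, mul_comm Y,
      ← lintegral_mul_const _ hwm]
    refine lintegral_mono fun η => ?_
    have h1 : wt (-s) η * Y ≤ ENNReal.ofReal (2 ^ s) * ∫⁻ ξ, wt s (ξ - η) * ‖𝓕 g ξ‖ₑ ^ 2 := by
      rw [hY, ← lintegral_const_mul' _ _ (by simp [wt]), ← lintegral_const_mul' _ _ (by finiteness)]
      refine lintegral_mono fun ξ => ?_
      have hp := wt_peetre (ξ - η) η s hs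
      rw [sub_add_cancel] at hp
      calc wt (-s) η * (wt s ξ * ‖𝓕 g ξ‖ₑ ^ 2)
          ≤ wt (-s) η * ((ENNReal.ofReal (2 ^ s) * wt s (ξ - η) * wt s η) * ‖𝓕 g ξ‖ₑ ^ 2) := by
            gcongr
        _ = (wt (-s) η * wt s η) * (ENNReal.ofReal (2 ^ s) * (wt s (ξ - η) * ‖𝓕 g ξ‖ₑ ^ 2)) := by
            ring
        _ = _ := by rw [wt_mul, neg_add_cancel, wt_zero, one_mul]
    calc _ = ‖𝓕 (fun t => (win M t : ℂ)) η‖ₑ ^ 2 * (wt (-s) η * Y) := by ring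
      _ ≤ ‖𝓕 (fun t => (win M t : ℂ)) η‖ₑ ^ 2 *
          (ENNReal.ofReal (2 ^ s) * ∫⁻ ξ, wt s (ξ - η) * ‖𝓕 g ξ‖ₑ ^ 2) := mul_le_mul_right h1 _
      _ = _ := by ring
  have := (ENNReal.le_div_iff_mul_le (Or.inl hc00) (Or.inl hc0t)).2 key
  rw [ENNReal.div_eq_inv_mul] at this
  refine this.trans (le_of_eq ?_)
  ring

theorem fourier_const_smul' (c : ℂ) (h : ℝ → ℂ) (ξ : ℝ) : 𝓕 (c • h) ξ = c * 𝓕 h ξ := by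
  rw [Real.fourier_real_eq, Real.fourier_real_eq, ← integral_const_mul]
  refine integral_congr_ae (Filter.Eventually.of_forall fun t => ?_)
  simp only [Pi.smul_apply, smul_eq_mul, Circle.smul_def]
  ring

/-- The localized multiplication estimate. -/
theorem boundD (s r M : ℝ) (hs : 0 ≤ s) (hr : 0 ≤ r) (hM : r + 1 ≤ M) : ∃ K : ℝ≥0∞, K ≠ ⊤ ∧
    ∀ f : ℝ → ℂ, Integrable f → ∀ x : ℝ,
      ∫⁻ ξ, wt s ξ * ‖𝓕 (fun t => (win (2 * M) (t - x) : ℂ) *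
          ((((1 + t ^ 2) ^ r : ℝ) : ℂ) * f t)) ξ‖ₑ ^ 2 ≤
        K * ∫⁻ ξ, wt (2 * r) x * (wt s ξ * ‖𝓕 (fun t => (win M (t - x) : ℂ) * f t) ξ‖ₑ ^ 2) := by
  obtain ⟨C, hC, hdec⟩ := chi_decay r M hr hM (⌈s⌉₊ + 1)
  have hN : s / 2 + 1 ≤ ((⌈s⌉₊ + 1 : ℕ) : ℝ) := by push_cast; linarith [Nat.le_ceil s]
  obtain ⟨K, hK, hmult⟩ := mult_bound s C _ hs hN
  refine ⟨K, hK, fun f hf x => ?_⟩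
  have hm := hmult (fun t => (chi r M x t : ℂ)) (fun t => (win M (t - x) : ℂ) * f t)
    (Complex.continuous_ofReal.comp (contDiff_chi r M x 0).continuous) (hdec x).1 (hdec x).2
    (win_mul_integrable (by linarith) hf x)
  have heq : (fun t => (win (2 * M) (t - x) : ℂ) * ((((1 + t ^ 2) ^ r : ℝ) : ℂ) * f t)) =
      (((1 + x ^ 2) ^ r : ℝ) : ℂ) • fun t => (chi r M x t : ℂ) * ((win M (t - x) : ℂ) * f t) := by
    ext t
    have h1 : win (2 * M) (t - x) * (1 + t ^ 2) ^ r =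
        (1 + x ^ 2) ^ r * (chi r M x t * win M (t - x)) := by
      unfold win chi
      have hx : 0 < 1 + x ^ 2 := by positivity
      rw [show -(2 * M) = -M + -M by ring, Real.rpow_add (by positivity), Real.rpow_neg hx.le]
      have : (1 + x ^ 2) ^ r ≠ 0 := by positivity
      field_simp
    have h2 := congrArg (fun y : ℝ => (y : ℂ)) h1
    simp only [Complex.ofReal_mul] at h2
    simp only [Pi.smul_apply, smul_eq_mul]
    linear_combination f t * h2
  have hfs : ∀ ξ, ‖𝓕 (fun t => (win (2 * M) (t - x) : ℂ) *
      ((((1 + t ^ 2) ^ r : ℝ) : ℂ) * f t)) ξ‖ₑ ^ 2 =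
      wt (2 * r) x * ‖𝓕 (fun t => (chi r M x t : ℂ) * ((win M (t - x) : ℂ) * f t)) ξ‖ₑ ^ 2 := by
    intro ξ
    rw [heq, fourier_const_smul', enorm_mul, enorm_wt, mul_pow, wt_sq]
  simp only [hfs]
  rw [lintegral_const_mul' _ _ (by simp [wt])]
  calc _ = wt (2 * r) x * ∫⁻ ξ, wt s ξ *
        ‖𝓕 (fun t => (chi r M x t : ℂ) * ((win M (t - x) : ℂ) * f t)) ξ‖ₑ ^ 2 := by
        rw [← lintegral_const_mul' _ _ (by simp [wt])]
        refine lintegral_congr fun ξ => ?_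
        ring
    _ ≤ wt (2 * r) x * _ := mul_le_mul_right hm _
    _ = _ := by ring


/-- The Hölder inequality on phase space. -/
theorem holder_step (a b θ : ℝ) (hθ0 : 0 ≤ θ) (h1θ : 0 ≤ 1 - θ) (V : ℝ × ℝ → ℝ≥0∞)
    (hmV : Measurable V) :
    ∫⁻ x, ∫⁻ ξ, wt (2 * ((1 - θ) * b / 2)) x * (wt (θ * a) ξ * V (x, ξ)) ≤
      (∫⁻ x, ∫⁻ ξ, wt b x * V (x, ξ)) ^ (1 - θ) * (∫⁻ x, ∫⁻ ξ, wt a ξ * V (x, ξ)) ^ θ := by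
  have hm1 : Measurable fun q : ℝ × ℝ => wt b q.1 * V q :=
    ((wt_measurable _).comp measurable_fst).mul hmV
  have hm2 : Measurable fun q : ℝ × ℝ => wt a q.2 * V q :=
    ((wt_measurable _).comp measurable_snd).mul hmV
  have hH := ENNReal.lintegral_mul_norm_pow_le (μ := (volume : Measure (ℝ × ℝ)))
    hm1.aemeasurable hm2.aemeasurable h1θ hθ0 (by ring)
  have hpt : ∀ q : ℝ × ℝ, (wt b q.1 * V q) ^ (1 - θ) * (wt a q.2 * V q) ^ θ =
      wt (2 * ((1 - θ) * b / 2)) q.1 * (wt (θ * a) q.2 * V q) := by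
    intro q
    rw [ENNReal.mul_rpow_of_nonneg _ _ h1θ, ENNReal.mul_rpow_of_nonneg _ _ hθ0,
      wt_rpow _ _ _ h1θ, wt_rpow _ _ _ hθ0, mul_mul_mul_comm,
      ← ENNReal.rpow_add_of_nonneg _ _ h1θ hθ0, sub_add_cancel, ENNReal.rpow_one, mul_assoc]
    congr 2
    · ring
    · rw [mul_comm]
  simp only [hpt] at hH
  have hm3 : Measurable fun q : ℝ × ℝ =>
      wt (2 * ((1 - θ) * b / 2)) q.1 * (wt (θ * a) q.2 * V q) :=
    ((wt_measurable _).comp measurable_fst).mul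
      (((wt_measurable _).comp measurable_snd).mul hmV)
  rw [Measure.volume_eq_prod, lintegral_prod _ hm1.aemeasurable, lintegral_prod _ hm2.aemeasurable,
    lintegral_prod _ hm3.aemeasurable] at hH
  exact hH

/-- Stein–Weiss type interpolation between decay and regularity: for `a, b > 0` and
`θ ∈ (0,1)` there is `c = c(a,b,θ)` such that
`‖J^{θa}(⟨x⟩^{(1-θ)b} f)‖_{L²} ≤ c ‖⟨x⟩^b f‖_{L²}^{1-θ} ‖J^a f‖_{L²}^θ`,
where the Bessel potential norms are expressed via the Fourier transform:
`‖J^s g‖_{L²}² = ∫ (1+ξ²)^s |ĝ(ξ)|² dξ` and `⟨x⟩ = (1+x²)^{1/2}`. -/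
theorem interpolation_decay_regularity (a b θ : ℝ) (ha : 0 < a) (hb : 0 < b)
    (hθ : θ ∈ Set.Ioo (0 : ℝ) 1) :
    ∃ c : ℝ, 0 < c ∧ ∀ f : ℝ → ℂ, Integrable f →
      Integrable (fun x : ℝ => (((1 + x ^ 2) ^ (b / 2) : ℝ) : ℂ) * f x) →
      (∫⁻ ξ : ℝ, ENNReal.ofReal ((1 + ξ ^ 2) ^ (θ * a) *
            ‖𝓕 (fun x : ℝ => (((1 + x ^ 2) ^ ((1 - θ) * b / 2) : ℝ) : ℂ) * f x) ξ‖ ^ 2)) ^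
          ((1 : ℝ) / 2) ≤
        ENNReal.ofReal c *
          ((∫⁻ x : ℝ, ENNReal.ofReal ((1 + x ^ 2) ^ b * ‖f x‖ ^ 2)) ^ ((1 : ℝ) / 2)) ^ (1 - θ) *
          ((∫⁻ ξ : ℝ, ENNReal.ofReal ((1 + ξ ^ 2) ^ a * ‖𝓕 f ξ‖ ^ 2)) ^ ((1 : ℝ) / 2)) ^ θ := by
  obtain ⟨hθ0, hθ1⟩ := hθ
  have hs : 0 ≤ θ * a := by positivity
  have h1θ : 0 ≤ 1 - θ := by linarith
  have hr : 0 ≤ (1 - θ) * b / 2 := by positivity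
  have hrb : (1 - θ) * b / 2 ≤ b := by nlinarith
  obtain ⟨KA, hKA, hA⟩ := boundA b (b + 1) hb.le le_rfl
  obtain ⟨KB, hKB, hB⟩ := boundB a (b + 1) ha.le (by linarith)
  obtain ⟨KC, hKC, hC⟩ := boundC (θ * a) (2 * (b + 1)) hs (by linarith)
  obtain ⟨KD, hKD, hD⟩ := boundD (θ * a) ((1 - θ) * b / 2) (b + 1) hs hr (by linarith)
  set K : ℝ≥0∞ := KC * KD * (KA ^ (1 - θ) * KB ^ θ) with hK
  have hKt : K ≠ ⊤ := by
    have := ENNReal.rpow_ne_top_of_nonneg h1θ hKA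
    have := ENNReal.rpow_ne_top_of_nonneg hθ0.le hKB
    finiteness
  have hK2 : K ^ (1 / 2 : ℝ) ≠ ⊤ := ENNReal.rpow_ne_top_of_nonneg (by norm_num) hKt
  refine ⟨(K ^ (1 / 2 : ℝ)).toReal + 1, by positivity, fun f hf hfb => ?_⟩
  simp only [ofReal_wt]
  set X := ∫⁻ x, wt b x * ‖f x‖ₑ ^ 2 with hX
  set Y := ∫⁻ ξ, wt a ξ * ‖𝓕 f ξ‖ₑ ^ 2 with hY
  have hg : Integrable (fun x : ℝ => (((1 + x ^ 2) ^ ((1 - θ) * b / 2) : ℝ) : ℂ) * f x) := by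
    refine hfb.norm.mono' ?_ (Filter.Eventually.of_forall fun t => ?_)
    · exact (Complex.continuous_ofReal.comp
        (contDiff_p _ 0).continuous).aestronglyMeasurable.mul hf.1
    · rw [norm_mul, norm_mul, Complex.norm_real, Complex.norm_real,
        Real.norm_of_nonneg (by positivity), Real.norm_of_nonneg (by positivity)]
      refine mul_le_mul_of_nonneg_right (Real.rpow_le_rpow_of_exponent_le ?_ ?_) (norm_nonneg _)
      · nlinarith [sq_nonneg t]
      · nlinarith
  have hmV : Measurable (fun q : ℝ × ℝ =>
      ‖𝓕 (fun t => (win (b + 1) (t - q.1) : ℂ) * f t) q.2‖ₑ ^ 2) :=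
    (stft_continuous hf (win_continuous _)
      (win_bound (by linarith))).enorm.measurable.pow_const 2
  have hH := holder_step a b θ hθ0.le h1θ _ hmV
  have main : ∫⁻ ξ, wt (θ * a) ξ *
      ‖𝓕 (fun x : ℝ => (((1 + x ^ 2) ^ ((1 - θ) * b / 2) : ℝ) : ℂ) * f x) ξ‖ₑ ^ 2 ≤
      K * (X ^ (1 - θ) * Y ^ θ) := by
    calc _ ≤ _ := hC _ hg
      _ ≤ KC * (KD * ((KA * X) ^ (1 - θ) * (KB * Y) ^ θ)) := by
          refine mul_le_mul_right ((lintegral_mono fun x => hD f hf x).trans ?_) _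
          rw [lintegral_const_mul' _ _ hKD]
          refine mul_le_mul_right (hH.trans ?_) _
          exact mul_le_mul' (ENNReal.rpow_le_rpow (hA f hf) h1θ)
            (ENNReal.rpow_le_rpow (hB f hf) hθ0.le)
      _ = _ := by
          rw [ENNReal.mul_rpow_of_nonneg _ _ h1θ, ENNReal.mul_rpow_of_nonneg _ _ hθ0.le, hK]
          ring
  clear_value K X Y
  refine (ENNReal.rpow_le_rpow main (by norm_num : (0 : ℝ) ≤ 1 / 2)).trans ?_
  rw [ENNReal.mul_rpow_of_nonneg K _ (by norm_num), ENNReal.mul_rpow_of_nonneg _ _ (by norm_num),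
    ← ENNReal.rpow_mul, ← ENNReal.rpow_mul, ← ENNReal.rpow_mul, ← ENNReal.rpow_mul,
    mul_comm (1 - θ), mul_comm θ, mul_assoc]
  refine mul_le_mul_left ?_ _
  refine (ENNReal.le_ofReal_iff_toReal_le hK2 (by positivity)).2 ?_
  linarith
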